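/- arXiv:2411.12160 — 3 statements merged into one kernel-verified Lean document; each statement's English description precedes it below -/
import Mathlib

section
/- Let T be a string, c a character, and suppose aub ∈ NUS(Tc) \ NUS(T) is a net unique substring of Tc that is not a suffix of Tc, where a, b, c are characters and u is a (possibly empty) string. Then u = lrSuf(Tc) and #occ_{Tc}(u) = 2. -/
open List

/-- Number of occurrences of `w` in `T`, i.e. the number of (1-indexed) intervals
`[i..j]` with `T[i..j] = w`.  The empty string has `T.length + 1` occurrences. -/
def countOcc {α : Type*} [DecidableEq α] (T w : List α) : ℕ :=
  ((Finset.range (T.length + 1)).filter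
    (fun i => i + w.length ≤ T.length ∧ (T.drop i).take w.length = w)).card

/-- `w` is unique in `T`: it has exactly one occurrence. -/
def uniqueIn {α : Type*} [DecidableEq α] (T w : List α) : Prop := countOcc T w = 1

/-- `w` is repeating (a repeat) in `T`: it has at least two occurrences. -/
def repeatingIn {α : Type*} [DecidableEq α] (T w : List α) : Prop := 2 ≤ countOcc T w

/-- `w` is quasi-unique in `T`: it has one or two occurrences. -/
def quasiUniqueIn {α : Type*} [DecidableEq α] (T w : List α) : Prop :=
  1 ≤ countOcc T w ∧ countOcc T w ≤ 2

/-- The (1-indexed) substring `T[i..j]`; `T[i..i-1]` is the empty string. -/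
def substr {α : Type*} (T : List α) (i j : ℕ) : List α := (T.drop (i - 1)).take (j + 1 - i)

/-- `[i..j]` (1-indexed, possibly empty with `j = i - 1`) is a net occurrence in `T`:
`2 ≤ i`, `j ≤ |T| - 1`, `T[i..j]` is repeating in `T`, and both `T[i-1..j]` and
`T[i..j+1]` are unique in `T`. -/
def NetOcc {α : Type*} [DecidableEq α] (T : List α) (i j : ℕ) : Prop :=
  2 ≤ i ∧ i - 1 ≤ j ∧ j + 1 ≤ T.length ∧
  repeatingIn T (substr T i j) ∧ uniqueIn T (substr T (i - 1) j) ∧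
  uniqueIn T (substr T i (j + 1))

/-- The set of net unique substrings of `T`: the strings `T[i-1..j+1]` for net
occurrences `[i..j]`. -/
def NUS {α : Type*} [DecidableEq α] (T : List α) : Set (List α) :=
  {w | ∃ i j, NetOcc T i j ∧ w = substr T (i - 1) (j + 1)}

/-- The set of extended net occurrences of `T`: the intervals `[i-1..j+1]` for net
occurrences `[i..j]`. -/
def ENO {α : Type*} [DecidableEq α] (T : List α) : Set (ℕ × ℕ) :=
  {p | 1 ≤ p.2 ∧ NetOcc T (p.1 + 1) (p.2 - 1)}

/-- The set of minimal unique substring (MUS) occurrences `[i..j]` in `T`: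
`T[i..j]` is unique in `T` while `T[i+1..j]` and `T[i..j-1]` are repeating in `T`. -/
def MUS {α : Type*} [DecidableEq α] (T : List α) : Set (ℕ × ℕ) :=
  {p | 1 ≤ p.1 ∧ p.1 ≤ p.2 ∧ p.2 ≤ T.length ∧ uniqueIn T (substr T p.1 p.2) ∧
       repeatingIn T (substr T (p.1 + 1) p.2) ∧ repeatingIn T (substr T p.1 (p.2 - 1))}

/-- `w` is the longest repeating suffix `lrSuf(T)` of `T`. -/
def IsLrSuf {α : Type*} [DecidableEq α] (T w : List α) : Prop :=
  w <:+ T ∧ repeatingIn T w ∧ ∀ v, v <:+ T → repeatingIn T v → v.length ≤ w.length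

/-- `w` is the shortest quasi-unique suffix `sqSuf(T)` of `T`. -/
def IsSqSuf {α : Type*} [DecidableEq α] (T w : List α) : Prop :=
  w <:+ T ∧ quasiUniqueIn T w ∧ ∀ v, v <:+ T → quasiUniqueIn T v → w.length ≤ v.length

/-- `w` is the longest repeating prefix `lrPref(T)` of `T`. -/
def IsLrPref {α : Type*} [DecidableEq α] (T w : List α) : Prop :=
  w <+: T ∧ repeatingIn T w ∧ ∀ v, v <+: T → repeatingIn T v → v.length ≤ w.length

/-- `w` is the shortest quasi-unique prefix `sqPref(T)` of `T`. -/
def IsSqPref {α : Type*} [DecidableEq α] (T w : List α) : Prop :=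
  w <+: T ∧ quasiUniqueIn T w ∧ ∀ v, v <+: T → quasiUniqueIn T v → w.length ≤ v.length

/-- `w` occurs in `T` at the 0-indexed position `p`. -/
def OccAt {α : Type*} (T w : List α) (p : ℕ) : Prop :=
  p + w.length ≤ T.length ∧ ∀ i, i < w.length → T[p + i]? = w[i]?

theorem occAt_iff {α : Type*} (T w : List α) (p : ℕ) :
    OccAt T w p ↔ (p + w.length ≤ T.length ∧ (T.drop p).take w.length = w) := by
  unfold OccAt
  refine and_congr_right fun h => ?_
  constructor
  · intro H
    apply List.ext_getElem?
    intro i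
    rw [List.getElem?_take]
    split_ifs with hi
    · rw [List.getElem?_drop, H i hi]
    · rw [List.getElem?_eq_none]; omega
  · intro H i hi
    have := congrArg (fun l => l[i]?) H
    simp only [List.getElem?_take, hi, if_true, List.getElem?_drop] at this
    exact this

theorem occAt_append {α : Type*} (T v w : List α) (p : ℕ) :
    OccAt T (v ++ w) p ↔ OccAt T v p ∧ OccAt T w (p + v.length) := by
  unfold OccAt
  simp only [List.length_append]
  constructor
  · rintro ⟨h, H⟩
    refine ⟨⟨by omega, fun i hi => ?_⟩, by omega, fun i hi => ?_⟩
    · rw [H i (by omega), List.getElem?_append_left hi]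
    · rw [add_assoc, H (v.length + i) (by omega), List.getElem?_append_right (by omega)]
      simp
  · rintro ⟨⟨h, H⟩, h', H'⟩
    refine ⟨by omega, fun i hi => ?_⟩
    by_cases hv : i < v.length
    · rw [H i hv, List.getElem?_append_left hv]
    · rw [List.getElem?_append_right (by omega), ← H' (i - v.length) (by omega)]
      congr 1; omega

theorem occAt_snoc {α : Type*} (T w : List α) (c : α) (p : ℕ) (h : p + w.length ≤ T.length) :
    OccAt (T ++ [c]) w p ↔ OccAt T w p := by
  unfold OccAt
  simp only [List.length_append, List.length_singleton]
  constructor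
  · rintro ⟨_, H⟩
    exact ⟨h, fun i hi => by rw [← H i hi, List.getElem?_append_left (by omega)]⟩
  · rintro ⟨_, H⟩
    exact ⟨by omega, fun i hi => by rw [← H i hi, List.getElem?_append_left (by omega)]⟩

theorem occAt_suffix {α : Type*} (T w : List α) :
    w <:+ T ↔ OccAt T w (T.length - w.length) := by
  rw [occAt_iff, List.suffix_iff_eq_drop]
  constructor
  · intro h
    have hl : w.length ≤ T.length := by
      have := congrArg List.length h
      simp at this
      omega
    refine ⟨by omega, ?_⟩
    rw [← h, List.take_length]
  · rintro ⟨h, H⟩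
    rw [List.take_of_length_le (by simp; omega)] at H
    exact H.symm

theorem occAt_inj {α : Type*} (T v w : List α) (p : ℕ) (h : OccAt T v p) (h' : OccAt T w p)
    (hl : v.length = w.length) : v = w := by
  rw [occAt_iff] at h h'
  rw [← h.2, ← h'.2, hl]

open Classical in
theorem countOcc_eq {α : Type*} [DecidableEq α] (T w : List α) :
    countOcc T w = ((Finset.range (T.length + 1)).filter (fun i => OccAt T w i)).card := by
  unfold countOcc
  congr 1
  ext i
  simp [occAt_iff]

theorem OccAt.le {α : Type*} {T w : List α} {p : ℕ} (h : OccAt T w p) : p < T.length + 1 := by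
  have := h.1; omega

theorem uniq_eq {α : Type*} [DecidableEq α] {T w : List α} {p q : ℕ} (h : uniqueIn T w)
    (hp : OccAt T w p) (hq : OccAt T w q) : p = q := by
  classical
  unfold uniqueIn at h
  rw [countOcc_eq] at h
  exact Finset.card_le_one.1 h.le p (by simp [hp, hp.le]) q (by simp [hq, hq.le])

theorem uniq_of {α : Type*} [DecidableEq α] {T w : List α} {p : ℕ}
    (hp : OccAt T w p) (H : ∀ q, OccAt T w q → q = p) : uniqueIn T w := by
  classical
  unfold uniqueIn
  rw [countOcc_eq, Finset.card_eq_one]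
  refine ⟨p, ?_⟩
  ext q
  simp only [Finset.mem_filter, Finset.mem_range, Finset.mem_singleton]
  exact ⟨fun h => H q h.2, fun h => h ▸ ⟨hp.le, hp⟩⟩

theorem rep_iff {α : Type*} [DecidableEq α] {T w : List α} :
    repeatingIn T w ↔ ∃ p q, p ≠ q ∧ OccAt T w p ∧ OccAt T w q := by
  classical
  unfold repeatingIn
  rw [countOcc_eq]
  constructor
  · intro h
    obtain ⟨p, hp, q, hq, hne⟩ := Finset.one_lt_card.1 h
    exact ⟨p, q, hne, (Finset.mem_filter.1 hp).2, (Finset.mem_filter.1 hq).2⟩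
  · rintro ⟨p, q, hne, hp, hq⟩
    exact Finset.one_lt_card.2 ⟨p, by simp [hp, hp.le], q, by simp [hq, hq.le], hne⟩

theorem nus_iff {α : Type*} [DecidableEq α] (T : List α) (a b : α) (u : List α) :
    (a :: u ++ [b]) ∈ NUS T ↔ ∃ k, OccAt T (a :: u ++ [b]) k ∧ repeatingIn T u ∧
      uniqueIn T (a :: u) ∧ uniqueIn T (u ++ [b]) := by
  have key : ∀ k, OccAt T (a :: u ++ [b]) k →
      substr T (k + 2) (k + u.length + 1) = u ∧ substr T (k + 1) (k + u.length + 1) = a :: u ∧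
      substr T (k + 2) (k + u.length + 2) = u ++ [b] ∧
      substr T (k + 1) (k + u.length + 2) = a :: u ++ [b] := by
    intro k hk
    have h1 := (occAt_append T _ _ _).1 hk
    have hk' : OccAt T ([a] ++ (u ++ [b])) k := by simpa using hk
    have h2 := (occAt_append T _ _ _).1 hk'
    have h3 := (occAt_append T _ _ _).1 h2.2
    have g0 := ((occAt_iff _ _ _).1 hk).2
    have g1 := ((occAt_iff _ _ _).1 h1.1).2
    have g2 := ((occAt_iff _ _ _).1 h2.2).2
    have g3 := ((occAt_iff _ _ _).1 h3.1).2
    simp only [List.length_append, List.length_cons, List.length_nil] at g0 g1 g2 g3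
    unfold substr
    refine ⟨?_, ?_, ?_, ?_⟩
    · convert g3 using 2
      · omega
      · rfl
    · convert g1 using 2
      · omega
      · rfl
    · convert g2 using 2
      · omega
      · rfl
    · convert g0 using 2
      · omega
      · rfl
  constructor
  · rintro ⟨i, j, ⟨hi, hij, hj, hr, hu1, hu2⟩, hw⟩
    obtain ⟨k, rfl⟩ : ∃ k, i = k + 2 := ⟨i - 2, by omega⟩
    have hl := congrArg List.length hw
    simp [substr] at hl
    have hocc : OccAt T (a :: u ++ [b]) k := by
      rw [occAt_iff]
      simp only [List.length_append, List.length_cons, List.length_nil]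
      refine ⟨by omega, ?_⟩
      rw [hw]
      unfold substr
      congr 1; omega
    obtain rfl : j = k + u.length + 1 := by omega
    obtain ⟨e1, e2, e3, e4⟩ := key k hocc
    refine ⟨k, hocc, ?_, ?_, ?_⟩
    · rwa [e1] at hr
    · have : k + 2 - 1 = k + 1 := rfl
      rwa [this, e2] at hu1
    · rwa [e3] at hu2
  · rintro ⟨k, hocc, hr, hu1, hu2⟩
    obtain ⟨e1, e2, e3, e4⟩ := key k hocc
    have hl := hocc.1
    simp at hl
    refine ⟨k + 2, k + u.length + 1, ⟨by omega, by omega, by omega, ?_, ?_, ?_⟩, ?_⟩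
    · rwa [e1]
    · have : k + 2 - 1 = k + 1 := rfl
      rwa [this, e2]
    · rwa [e3]
    · exact e4.symm

/-- If `aub ∈ NUS(Tc) \ NUS(T)` is not a suffix of `Tc`, then `u = lrSuf(Tc)` and
`#occ_{Tc}(u) = 2`. -/
theorem added_net_occurrence_nonsuffix {α : Type*} [DecidableEq α] (T : List α)
    (a b c : α) (u : List α)
    (h1 : (a :: u ++ [b]) ∈ NUS (T ++ [c])) (h2 : (a :: u ++ [b]) ∉ NUS T)
    (h3 : ¬ (a :: u ++ [b]) <:+ (T ++ [c])) :
    IsLrSuf (T ++ [c]) u ∧ countOcc (T ++ [c]) u = 2 := by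
  obtain ⟨k, hk, hr, hu1, hu2⟩ := (nus_iff _ _ _ _).1 h1
  have hkl := hk.1
  have hlen : (T ++ [c]).length = T.length + 1 := by simp
  have hwlen : (a :: u ++ [b]).length = u.length + 2 := by simp
  rw [hlen, hwlen] at hkl
  have hkT : k + u.length + 2 ≤ T.length := by
    by_contra hcon
    apply h3
    rw [occAt_suffix, hlen, hwlen]
    have : T.length + 1 - (u.length + 2) = k := by omega
    rwa [this]
  have hkk : OccAt T (a :: u ++ [b]) k := (occAt_snoc _ _ c _ (by rw [hwlen]; omega)).1 hk
  have hau := ((occAt_append T _ _ _).1 hkk).1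
  have hub : OccAt T (u ++ [b]) (k + 1) := by
    have : OccAt T ([a] ++ (u ++ [b])) k := by simpa using hkk
    exact ((occAt_append T _ _ _).1 this).2
  have hu : OccAt T u (k + 1) := ((occAt_append T _ _ _).1 hub).1
  have up : ∀ w p, OccAt T w p → OccAt (T ++ [c]) w p := fun w p h =>
    (occAt_snoc _ _ c _ h.1).2 h
  have hnr : ¬ repeatingIn T u := by
    intro hru
    apply h2
    rw [nus_iff]
    exact ⟨k, hkk, hru, uniq_of hau fun q hq => uniq_eq hu1 (up _ _ hq) (up _ _ hau),
      uniq_of hub fun q hq => uniq_eq hu2 (up _ _ hq) (up _ _ hub)⟩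
  -- occurrences of `u` in `Tc` are the one at `k + 1` and the suffix
  have hocc : ∀ p, OccAt (T ++ [c]) u p → p = k + 1 ∨ p = T.length + 1 - u.length := by
    intro p hp
    have hpl := hp.1
    rw [hlen] at hpl
    by_cases hle : p + u.length ≤ T.length
    · left
      by_contra hne
      exact hnr (rep_iff.2 ⟨p, k + 1, hne, (occAt_snoc _ _ c _ hle).1 hp, hu⟩)
    · right; omega
  have hsuf : OccAt (T ++ [c]) u (T.length + 1 - u.length) := by
    obtain ⟨p, q, hne, hp, hq⟩ := rep_iff.1 hr
    rcases hocc p hp with h | h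
    · rcases hocc q hq with h' | h'
      · omega
      · rwa [← h']
    · rwa [← h]
  refine ⟨⟨?_, hr, ?_⟩, ?_⟩
  · rw [occAt_suffix, hlen]; exact hsuf
  · intro v hv hvr
    by_contra hlt
    push Not at hlt
    have hvs : OccAt (T ++ [c]) v (T.length + 1 - v.length) := by
      rw [← hlen]; exact (occAt_suffix _ _).1 hv
    have hvl := hvs.1
    rw [hlen] at hvl
    -- the repeat `v` has an occurrence that is not the suffix
    obtain ⟨p, hp, hpne⟩ : ∃ p, OccAt (T ++ [c]) v p ∧ p ≠ T.length + 1 - v.length := by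
      obtain ⟨p, q, hne, hp, hq⟩ := rep_iff.1 hvr
      by_cases h : p = T.length + 1 - v.length
      · exact ⟨q, hq, by omega⟩
      · exact ⟨p, hp, h⟩
    have hpl := hp.1
    rw [hlen] at hpl
    -- transfer between the two occurrences
    have htr : ∀ i, i < v.length →
        (T ++ [c])[p + i]? = (T ++ [c])[T.length + 1 - v.length + i]? := fun i hi => by
      rw [hp.2 i hi, hvs.2 i hi]
    have hup : OccAt (T ++ [c]) u (p + (v.length - u.length)) := by
      refine ⟨by rw [hlen]; omega, fun i hi => ?_⟩
      rw [← hsuf.2 i hi, add_assoc, htr _ (by omega)]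
      congr 1; omega
    have hpk : p + (v.length - u.length) = k + 1 := by
      rcases hocc _ hup with h | h
      · exact h
      · omega
    have hau' := up _ _ hau
    have : OccAt (T ++ [c]) (a :: u) (T.length - u.length) := by
      refine ⟨by rw [hlen]; simp; omega, fun i hi => ?_⟩
      rw [← hau'.2 i hi]
      simp only [List.length_cons] at hi
      have := htr (v.length - u.length - 1 + i) (by omega)
      have e1 : p + (v.length - u.length - 1 + i) = k + i := by omega
      have e2 : T.length + 1 - v.length + (v.length - u.length - 1 + i)
        = T.length - u.length + i := by omega
      rw [e1, e2] at this
      exact this.symm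
    have := uniq_eq hu1 this hau'
    omega
  · classical
    refine le_antisymm ?_ hr
    rw [countOcc_eq]
    refine le_trans (Finset.card_le_card (t := {k + 1, T.length + 1 - u.length}) ?_)
      Finset.card_le_two
    intro p hp
    simpa using hocc p (Finset.mem_filter.1 hp).2
end

section
/- Let T be a string, c a character, and suppose auc ∈ NUS(Tc) \ NUS(T) is a net unique substring of Tc that is a suffix of Tc, where a, c are characters and u is a (possibly empty) string. Then either (i) u = lrSuf(T), or (ii) u = c^exp and #occ_T(u) = 1, where exp = max{e : c^e is a suffix of T}. -/
open List

/-- The set of starting offsets of `w` in `T`. -/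
def occSet {α : Type*} [DecidableEq α] (T w : List α) : Finset ℕ :=
  (Finset.range (T.length + 1)).filter
    (fun i => i + w.length ≤ T.length ∧ (T.drop i).take w.length = w)

lemma mem_occSet {α : Type*} [DecidableEq α] (T w : List α) (i : ℕ) :
    i ∈ occSet T w ↔ ∃ p s, T = p ++ w ++ s ∧ p.length = i := by
  unfold occSet
  simp only [Finset.mem_filter, Finset.mem_range]
  constructor
  · rintro ⟨h0, h1, h2⟩
    refine ⟨T.take i, (T.drop i).drop w.length, ?_, ?_⟩
    · conv_lhs => rw [← List.take_append_drop i T, ← List.take_append_drop w.length (T.drop i), h2]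
      simp
    · simp; omega
  · rintro ⟨p, s, rfl, rfl⟩
    simp

lemma countOcc_suffix_le {α : Type*} [DecidableEq α] (T v w : List α) (h : w <:+ v) :
    countOcc T v ≤ countOcc T w := by
  obtain ⟨q, rfl⟩ := h
  change (occSet T (q ++ w)).card ≤ (occSet T w).card
  refine Finset.card_le_card_of_injOn (fun i => i + q.length) ?_ ?_
  · intro i hi
    obtain ⟨p, s, h, rfl⟩ := (mem_occSet _ _ _).1 hi
    exact (mem_occSet _ _ _).2 ⟨p ++ q, s, by simp [h], by simp⟩
  · intro i _ j _ h
    simpa using h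

lemma countOcc_le_append {α : Type*} [DecidableEq α] (T w : List α) (c : α) :
    countOcc T w ≤ countOcc (T ++ [c]) w := by
  change (occSet T w).card ≤ (occSet (T ++ [c]) w).card
  refine Finset.card_le_card ?_
  intro i hi
  obtain ⟨p, s, h, rfl⟩ := (mem_occSet _ _ _).1 hi
  exact (mem_occSet _ _ _).2 ⟨p, s ++ [c], by simp [h], rfl⟩

lemma countOcc_append_le {α : Type*} [DecidableEq α] (T w : List α) (c : α)
    (hn : ¬ w <:+ T ++ [c]) : countOcc (T ++ [c]) w ≤ countOcc T w := by
  change (occSet (T ++ [c]) w).card ≤ (occSet T w).card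
  refine Finset.card_le_card ?_
  intro i hi
  obtain ⟨p, s, h, rfl⟩ := (mem_occSet _ _ _).1 hi
  rcases List.eq_nil_or_concat s with rfl | ⟨s', d, rfl⟩
  · exact absurd ⟨p, by simp [h]⟩ hn
  · rw [List.concat_eq_append, ← List.append_assoc] at h
    exact (mem_occSet _ _ _).2 ⟨p, s', (List.append_inj' h rfl).1, rfl⟩

lemma cons_eq_concat {α : Type*} (c : α) (u : List α) (x : α) (h : x :: u = u ++ [c]) :
    x :: u = List.replicate (u.length + 1) c := by
  induction u generalizing x with
  | nil => simpa using h
  | cons y u ih =>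
    simp only [List.cons_append, List.cons.injEq] at h
    obtain ⟨rfl, h⟩ := h
    have h' := ih _ h
    have hx : x = c := by
      rw [List.replicate_succ] at h'
      exact (List.cons.inj h').1
    rw [h', hx]
    simp [List.replicate_succ]

lemma countOcc_pos_of_suffix {α : Type*} [DecidableEq α] (T w : List α) (h : w <:+ T) :
    1 ≤ countOcc T w := by
  change 0 < (occSet T w).card
  obtain ⟨p, rfl⟩ := h
  exact Finset.card_pos.2 ⟨p.length, (mem_occSet _ _ _).2 ⟨p, [], by simp, rfl⟩⟩

lemma two_le_replicate {α : Type*} [DecidableEq α] (T : List α) (c : α) (k : ℕ)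
    (h : List.replicate (k + 1) c <:+ T) : 2 ≤ countOcc T (List.replicate k c) := by
  change 1 < (occSet T _).card
  obtain ⟨p, rfl⟩ := h
  refine Finset.one_lt_card.2 ⟨p.length, (mem_occSet _ _ _).2 ⟨p, [c], ?_, rfl⟩,
    p.length + 1, (mem_occSet _ _ _).2 ⟨p ++ [c], [], ?_, by simp⟩, by omega⟩
  · simp [List.replicate_succ']
  · simp [List.replicate_succ]

lemma NUS_facts {α : Type*} [DecidableEq α] (S : List α) (a c : α) (u : List α)
    (h : (a :: u ++ [c]) ∈ NUS S) :
    2 ≤ countOcc S u ∧ countOcc S (a :: u) = 1 := by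
  obtain ⟨i, j, ⟨hi, hij, hj, hr, hl, -⟩, he⟩ := h
  obtain ⟨k, rfl⟩ : ∃ k, i = k + 2 := ⟨i - 2, by omega⟩
  obtain ⟨m, rfl⟩ : ∃ m, j = k + m + 1 := ⟨j - k - 1, by omega⟩
  have e1 : k + m + 1 + 1 - (k + 2) = m := by omega
  have e2 : k + m + 1 + 1 - (k + 1) = m + 1 := by omega
  have e3 : k + m + 1 + 1 + 1 - (k + 1) = m + 2 := by omega
  have x1 : k + 2 - 1 = k + 1 := by omega
  have x2 : k + 1 - 1 = k := by omega
  unfold repeatingIn at hr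
  unfold uniqueIn at hl
  simp only [substr, x1, x2, e1, e2, e3] at hr hl he
  have hlen := congrArg List.length he
  simp at hlen
  have hum : u.length = m := by omega
  have h4 := congrArg (List.take (m + 1)) he
  rw [List.take_take, Nat.min_eq_left (by omega)] at h4
  have h5 : List.take (m + 1) (a :: u ++ [c]) = a :: u := by
    simp [← hum]
  rw [h5] at h4
  have h6 := congrArg List.tail h4
  rw [← List.drop_one, ← List.drop_one, List.drop_take, List.drop_drop] at h6
  simp only [List.drop_one, List.tail_cons, Nat.add_sub_cancel] at h6
  rw [h4, h6]
  exact ⟨hr, hl⟩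

/-- If `auc ∈ NUS(Tc) \ NUS(T)` is a suffix of `Tc`, then (i) `u = lrSuf(T)`, or
(ii) `u = c^exp` and `#occ_T(u) = 1`, where `exp = max{e : c^e is a suffix of T}`. -/
theorem added_net_occurrence_suffix {α : Type*} [DecidableEq α] (T : List α)
    (a c : α) (u : List α) (exp : ℕ)
    (hexp1 : List.replicate exp c <:+ T) (hexp2 : ∀ e, List.replicate e c <:+ T → e ≤ exp)
    (h1 : (a :: u ++ [c]) ∈ NUS (T ++ [c])) (h2 : (a :: u ++ [c]) ∉ NUS T)
    (h3 : (a :: u ++ [c]) <:+ (T ++ [c])) :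
    IsLrSuf T u ∨ (u = List.replicate exp c ∧ countOcc T u = 1) := by
  obtain ⟨hr, hu⟩ := NUS_facts _ _ _ _ h1
  have hau : (a :: u) <:+ T := by
    obtain ⟨p, hp⟩ := h3
    rw [← List.append_assoc] at hp
    exact ⟨p, (List.append_inj' hp rfl).1⟩
  have huT : u <:+ T := (List.suffix_cons a u).trans hau
  by_cases hc : 2 ≤ countOcc T u
  · left
    refine ⟨huT, hc, fun v hv hrv => ?_⟩
    by_contra hlt
    have hs : (a :: u) <:+ v := List.suffix_of_suffix_length_le hau hv (by simp; omega)
    have k1 := countOcc_suffix_le T v _ hs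
    have k2 := countOcc_le_append T (a :: u) c
    unfold repeatingIn at hrv
    omega
  · right
    have hpos := countOcc_pos_of_suffix T u huT
    refine ⟨?_, by omega⟩
    have hsuf : u <:+ T ++ [c] := by
      by_contra hn
      have := countOcc_append_le T u c hn
      omega
    have huc : (u ++ [c]) <:+ T ++ [c] := (List.suffix_cons a (u ++ [c])).trans h3
    obtain ⟨q, hq⟩ := List.suffix_of_suffix_length_le hsuf huc (by simp)
    have hql : q.length = 1 := by
      have := congrArg List.length hq
      simp at this
      omega
    obtain ⟨x, rfl⟩ := List.length_eq_one_iff.1 hql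
    have hrep := cons_eq_concat c u x hq
    have hrep' : u = List.replicate u.length c := by
      rw [List.replicate_succ] at hrep
      exact (List.cons.inj hrep).2
    have hle : u.length ≤ exp := hexp2 _ (hrep' ▸ huT)
    have hge : ¬ u.length + 1 ≤ exp := by
      intro hlt
      apply hc
      have hs : List.replicate (u.length + 1) c <:+ T := by
        refine List.IsSuffix.trans ⟨List.replicate (exp - (u.length + 1)) c, ?_⟩ hexp1
        rw [← List.replicate_add]
        congr 1
        omega
      have := two_le_replicate T c u.length hs
      rwa [← hrep'] at this
    have : u.length = exp := by omega
    rw [← this]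
    exact hrep'
end

section
/- For any string T of length n > 2, #ENO(T) = #MUS(T) − 1, i.e., the number of extended net occurrences in T is exactly one less than the number of MUS occurrences in T. -/
open List

theorem countOcc_mono {α : Type*} [DecidableEq α] (T x v y : List α) :
    countOcc T (x ++ v ++ y) ≤ countOcc T v := by
  unfold countOcc
  refine Finset.card_le_card_of_injOn (fun i => i + x.length) ?_ ?_
  · intro i hi
    simp only [Finset.coe_filter, Finset.mem_range, Set.mem_ofPred_eq, List.length_append] at hi ⊢
    obtain ⟨h1, h2, h3⟩ := hi
    refine ⟨by omega, by omega, ?_⟩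
    have h4 : T.drop i = x ++ (v ++ (y ++ (T.drop i).drop (x.length + v.length + y.length))) := by
      conv_lhs => rw [← List.take_append_drop (x.length + v.length + y.length) (T.drop i), h3]
      simp
    rw [← List.drop_drop, h4]
    simp
  · intro a _ b _ h
    simpa using h

theorem countOcc_nil {α : Type*} [DecidableEq α] (T : List α) :
    countOcc T [] = T.length + 1 := by
  unfold countOcc
  rw [Finset.filter_true_of_mem]
  · simp
  · intro i hi
    simp at hi ⊢
    omega

theorem substr_empty {α : Type*} (T : List α) (i j : ℕ) (h : j < i) : substr T i j = [] := by
  unfold substr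
  have : j + 1 - i = 0 := by omega
  simp [this]

theorem countOcc_pos {α : Type*} [DecidableEq α] (T : List α) (a j : ℕ) (hj : j ≤ T.length) :
    1 ≤ countOcc T (substr T (a + 1) j) := by
  by_cases h : j < a + 1
  · rw [substr_empty T _ _ h, countOcc_nil]; omega
  · have hl : (substr T (a + 1) j).length = j - a := by
      simp [substr]; omega
    unfold countOcc
    rw [hl]
    refine Finset.card_pos.mpr ⟨a, ?_⟩
    simp only [Finset.mem_filter, Finset.mem_range]
    refine ⟨by omega, by omega, ?_⟩
    simp [substr]

theorem rep_iff_s13 {α : Type*} [DecidableEq α] (T : List α) (a j : ℕ) (hj : j ≤ T.length) :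
    repeatingIn T (substr T (a + 1) j) ↔ ¬ uniqueIn T (substr T (a + 1) j) := by
  have := countOcc_pos T a j hj
  unfold repeatingIn uniqueIn
  omega

theorem unique_of_lt {α : Type*} [DecidableEq α] (T : List α) (i j : ℕ) (hT : 0 < T.length)
    (h : j < i) : ¬ uniqueIn T (substr T i j) := by
  unfold uniqueIn
  rw [substr_empty T _ _ h, countOcc_nil]
  omega

theorem unique_left {α : Type*} [DecidableEq α] (T : List α) (a j : ℕ) (hT : 0 < T.length)
    (hj : j ≤ T.length) (h : uniqueIn T (substr T (a + 1 + 1) j)) :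
    uniqueIn T (substr T (a + 1) j) := by
  by_cases h' : j < a + 1 + 1
  · exact absurd h (unique_of_lt T _ _ hT h')
  · have hs : substr T (a + 1) j = (T.drop a).take 1 ++ substr T (a + 1 + 1) j ++ [] := by
      have e : j + 1 - (a + 1) = 1 + (j + 1 - (a + 1 + 1)) := by omega
      unfold substr
      rw [e, List.take_add]
      simp
    have h1 := countOcc_mono T ((T.drop a).take 1) (substr T (a + 1 + 1) j) []
    rw [← hs] at h1
    have := countOcc_pos T a j hj
    unfold uniqueIn at *
    omega

theorem unique_right {α : Type*} [DecidableEq α] (T : List α) (a j : ℕ) (hT : 0 < T.length)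
    (hj : j + 1 ≤ T.length) (h : uniqueIn T (substr T (a + 1) j)) :
    uniqueIn T (substr T (a + 1) (j + 1)) := by
  by_cases h' : j < a + 1
  · exact absurd h (unique_of_lt T _ _ hT h')
  · have hs : substr T (a + 1) (j + 1) = [] ++ substr T (a + 1) j ++ (T.drop j).take 1 := by
      have e : j + 1 + 1 - (a + 1) = (j + 1 - (a + 1)) + 1 := by omega
      have e' : a + (j - a) = j := by omega
      unfold substr
      rw [e, List.take_add]
      simp [e']
    have h1 := countOcc_mono T [] (substr T (a + 1) j) ((T.drop j).take 1)
    rw [← hs] at h1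
    have := countOcc_pos T a (j + 1) hj
    unfold uniqueIn at *
    omega

theorem unique_full {α : Type*} [DecidableEq α] (T : List α) :
    uniqueIn T (substr T 1 T.length) := by
  unfold uniqueIn countOcc
  rw [Finset.card_eq_one]
  refine ⟨0, ?_⟩
  ext i
  rw [Finset.mem_filter, Finset.mem_range, Finset.mem_singleton]
  constructor
  · rintro ⟨_, h, _⟩
    simp [substr] at h
    exact h
  · rintro rfl
    simp [substr]

/-- Indicator of uniqueness. -/
noncomputable def uInd {α : Type*} [DecidableEq α] (T : List α) (i j : ℕ) : ℤ :=
  open Classical in if uniqueIn T (substr T i j) then 1 else 0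

theorem MUS_ncard {α : Type*} [DecidableEq α] (T : List α) (P : Set (ℕ × ℕ)) 
    (hP : ∀ p ∈ P, 1 ≤ p.1 ∧ p.1 ≤ T.length ∧ 1 ≤ p.2 ∧ p.2 ≤ T.length) :
    open Classical in
    (P.ncard : ℤ) = ∑ a ∈ Finset.range T.length, ∑ b ∈ Finset.range T.length,
      if (a + 1, b + 1) ∈ P then 1 else 0 := by
  classical
  have h : P = ↑(((Finset.range T.length ×ˢ Finset.range T.length).filter
      (fun q => (q.1 + 1, q.2 + 1) ∈ P)).image (fun q => (q.1 + 1, q.2 + 1))) := by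
    ext ⟨i, j⟩
    simp only [Finset.coe_image, Finset.coe_filter, Finset.mem_product, Finset.mem_range,
      Set.mem_image, Set.mem_ofPred_eq, Prod.mk.injEq, Prod.exists]
    constructor
    · intro hp
      have := hP _ hp
      simp only at this
      refine ⟨i - 1, j - 1, ⟨by omega, ?_⟩, by omega, by omega⟩
      rwa [Nat.sub_add_cancel (by omega), Nat.sub_add_cancel (by omega)]
    · rintro ⟨a, b, ⟨_, h⟩, rfl, rfl⟩
      exact h
  conv_lhs => rw [h]
  rw [Set.ncard_coe_finset, Finset.card_image_of_injective, Finset.card_filter,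
    Finset.sum_product]
  · push_cast
    rfl
  · rintro ⟨a, b⟩ ⟨c, d⟩ h
    simpa using h

/-- The number of extended net occurrences in `T` is exactly one less than the
number of MUS occurrences in `T`. -/
theorem ENO_card_eq_MUS_card_sub_one {α : Type*} [DecidableEq α] (T : List α)
    (hn : 2 < T.length) : (MUS T).ncard = (ENO T).ncard + 1 := by
  classical
  have hT : 0 < T.length := by omega
  have hM := MUS_ncard T (MUS T) (by
    rintro ⟨i, j⟩ ⟨h1, h2, h3, _⟩
    simp only at *
    omega)
  have hE := MUS_ncard T (ENO T) (by
    rintro ⟨i, j⟩ ⟨h1, h2, h3, h4, _⟩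
    simp only at *
    omega)
  have key : ∀ a ∈ Finset.range T.length, ∀ b ∈ Finset.range T.length,
      ((if (a + 1, b + 1) ∈ MUS T then 1 else 0) - (if (a + 1, b + 1) ∈ ENO T then 1 else 0) : ℤ)
        = (uInd T (a + 1) (b + 1) - uInd T (a + 1) b)
          - (uInd T (a + 1 + 1) (b + 1) - uInd T (a + 1 + 1) b) := by
    intro a ha b hb
    rw [Finset.mem_range] at ha hb
    have l1 := unique_left T a (b + 1) hT (by omega)
    have l2 := unique_left T a b hT (by omega)
    have r1 := unique_right T a b hT (by omega)
    have r2 := unique_right T (a + 1) b hT (by omega)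
    have e1 := unique_of_lt T (a + 1) (b + 1) hT
    have e2 := unique_of_lt T (a + 1) b hT
    have mM : (a + 1, b + 1) ∈ MUS T ↔ uniqueIn T (substr T (a + 1) (b + 1)) ∧
        ¬ uniqueIn T (substr T (a + 1 + 1) (b + 1)) ∧ ¬ uniqueIn T (substr T (a + 1) b) := by
      simp only [MUS, Set.mem_ofPred_eq, Nat.add_sub_cancel]
      rw [rep_iff_s13 T (a + 1) (b + 1) (by omega), rep_iff_s13 T a b (by omega)]
      constructor
      · rintro ⟨_, _, _, h1, h2, h3⟩
        exact ⟨h1, h2, h3⟩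
      · rintro ⟨h1, h2⟩
        refine ⟨by omega, ?_, by omega, h1, h2⟩
        by_contra h
        exact e1 (by omega) h1
    have mE : (a + 1, b + 1) ∈ ENO T ↔ ¬ uniqueIn T (substr T (a + 1 + 1) b) ∧
        uniqueIn T (substr T (a + 1) b) ∧ uniqueIn T (substr T (a + 1 + 1) (b + 1)) := by
      simp only [ENO, NetOcc, Set.mem_ofPred_eq, Nat.add_sub_cancel]
      rw [rep_iff_s13 T (a + 1) b (by omega)]
      constructor
      · rintro ⟨_, _, _, _, h1, h2, h3⟩
        exact ⟨h1, h2, h3⟩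
      · rintro ⟨h1, h2, h3⟩
        refine ⟨by omega, by omega, ?_, by omega, h1, h2, h3⟩
        by_contra h
        exact e2 (by omega) h2
    simp only [mM, mE, uInd]
    clear e1 e2 mM mE hM hE
    by_cases c1 : uniqueIn T (substr T (a + 1) (b + 1)) <;>
    by_cases c2 : uniqueIn T (substr T (a + 1 + 1) (b + 1)) <;>
    by_cases c3 : uniqueIn T (substr T (a + 1) b) <;>
    by_cases c4 : uniqueIn T (substr T (a + 1 + 1) b) <;>
    simp_all
  have hsum : ((MUS T).ncard : ℤ) - (ENO T).ncard = 1 := by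
    rw [hM, hE, ← Finset.sum_sub_distrib]
    simp only [← Finset.sum_sub_distrib]
    rw [Finset.sum_congr rfl (fun a ha => Finset.sum_congr rfl (key a ha))]
    have : ∀ a, ∑ b ∈ Finset.range T.length, ((uInd T (a + 1) (b + 1) - uInd T (a + 1) b)
          - (uInd T (a + 1 + 1) (b + 1) - uInd T (a + 1 + 1) b))
          = uInd T (a + 1) T.length - uInd T (a + 1 + 1) T.length := by
      intro a
      rw [Finset.sum_sub_distrib, Finset.sum_range_sub (fun b => uInd T (a + 1) b),
        Finset.sum_range_sub (fun b => uInd T (a + 1 + 1) b)]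
      simp [uInd, unique_of_lt T _ 0 hT]
    simp only [this]
    rw [Finset.sum_range_sub' (fun a => uInd T (a + 1) T.length)]
    simp [uInd, unique_full, unique_of_lt T (T.length + 1) T.length hT]
  omega
end
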